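/- arXiv:math/0512386 — 2 statements merged into one kernel-verified Lean document; each statement's English description precedes it below -/
import Mathlib

section
/- Let A be a nonempty finite set, let Q_X and Q_Y be strictly positive stochastic matrices on A with stationary probability vectors mu and mu~, and let P, P~ be the stationary Markov measures determined by (Q_X, mu) and (Q_Y, mu~). Then lim_{n->infinity} (1/n) E_{P tensor P~ tensor P} [ ( log( W_n(X|Y) / W_n(X|X') ) - sum_{i=1}^{n-1} log( Q_X(X_i, X_{i+1}) / Q_Y(X_i, X_{i+1}) ) )^2 ] = 0. -/
open MeasureTheory Filter Finset Real

/-- Waiting time: `W_n(x|y) = inf { k ≥ 1 : y_{k+i} = x_i for all 1 ≤ i ≤ n }`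
(with the convention `sInf ∅ = 0` in `ℕ`; the set is a.s. nonempty). -/
noncomputable def waitingTime {A : Type*} (n : ℕ) (x y : ℕ → A) : ℕ :=
  sInf {k | 1 ≤ k ∧ ∀ i, 1 ≤ i → i ≤ n → y (k + i) = x i}


set_option linter.unusedSectionVars false
set_option linter.unusedVariables false

section helpers
variable {A : Type*} [Fintype A] [MeasurableSpace A] [MeasurableSingletonClass A]

/-- A set of trajectories that depends only on the coordinates up to `m`. -/
def DepUpTo (m : ℕ) (S : Set (ℕ → A)) : Prop :=
  ∀ ω ω' : ℕ → A, (∀ i ≤ m, ω i = ω' i) → ω ∈ S → ω' ∈ S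

/-- The word `a 1 ... a n` occurs at position `m`. -/
def matchAt (n : ℕ) (a : ℕ → A) (m : ℕ) : Set (ℕ → A) :=
  {y | ∀ i, 1 ≤ i → i ≤ n → y (m + i) = a i}

/-- restriction to the first `m+1` coordinates -/
def restr (m : ℕ) (ω : ℕ → A) : Fin (m + 1) → A := fun i => ω i

lemma measurable_restr (m : ℕ) : Measurable (restr (A := A) m) := by
  unfold restr; fun_prop

lemma DepUpTo.exists_preimage {m : ℕ} {S : Set (ℕ → A)} (h : DepUpTo m S) :
    ∃ T : Finset (Fin (m + 1) → A), S = restr m ⁻¹' (T : Set (Fin (m + 1) → A)) := by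
  classical
  refine ⟨(Finset.univ.filter fun b => ∃ ω ∈ S, restr m ω = b), ?_⟩
  ext ω
  simp only [Finset.coe_filter, Finset.mem_univ, true_and, Set.mem_preimage, Set.mem_ofPred_eq]
  constructor
  · intro hω; exact ⟨ω, hω, rfl⟩
  · rintro ⟨ω', hω', he⟩
    refine h ω' ω (fun i hi => ?_) hω'
    exact congrFun he ⟨i, by omega⟩

lemma DepUpTo.measurableSet {m : ℕ} {S : Set (ℕ → A)} (h : DepUpTo m S) : MeasurableSet S := by
  obtain ⟨T, rfl⟩ := h.exists_preimage
  exact measurable_restr m (T.measurableSet)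

lemma dep_coord (m : ℕ) (x : A) : DepUpTo m {ω : ℕ → A | ω m = x} := by
  intro ω ω' h hω
  simp only [Set.mem_ofPred_eq] at *
  rw [← h m le_rfl, hω]

lemma DepUpTo.inter {m : ℕ} {S T : Set (ℕ → A)} (h : DepUpTo m S) (h' : DepUpTo m T) :
    DepUpTo m (S ∩ T) :=
  fun ω ω' e hω => ⟨h ω ω' e hω.1, h' ω ω' e hω.2⟩

lemma DepUpTo.mono {m k : ℕ} (hk : m ≤ k) {S : Set (ℕ → A)} (h : DepUpTo m S) :
    DepUpTo k S :=
  fun ω ω' e hω => h ω ω' (fun i hi => e i (hi.trans hk)) hω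

lemma dep_matchAt (n : ℕ) (a : ℕ → A) (m : ℕ) : DepUpTo (m + n) (matchAt n a m) := by
  intro ω ω' e hω i h1 h2
  rw [← e (m + i) (by omega)]; exact hω i h1 h2

lemma DepUpTo.compl {m : ℕ} {S : Set (ℕ → A)} (h : DepUpTo m S) : DepUpTo m Sᶜ :=
  fun ω ω' e hω hω' => hω (h ω' ω (fun i hi => (e i hi).symm) hω')

variable (Q : A → A → ℝ) (μ : A → ℝ) (P : Measure (ℕ → A)) [IsProbabilityMeasure P]

lemma cyl_step 
    (hP : ∀ (n : ℕ) (a : ℕ → A),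
      (P {ω | ∀ i ≤ n, ω i = a i}).toReal
        = μ (a 0) * ∏ i ∈ Finset.range n, Q (a i) (a (i + 1)))
    (m : ℕ) (b : Fin (m + 1) → A) (y : A) :
    P.real (restr m ⁻¹' {b} ∩ {ω | ω (m + 1) = y})
      = P.real (restr m ⁻¹' {b}) * Q (b (Fin.last m)) y := by
  let a : ℕ → A := fun i => if h : i < m + 1 then b ⟨i, h⟩ else y
  have ha : ∀ i (h : i < m + 1), a i = b ⟨i, h⟩ := fun i h => dif_pos h
  have h1 : restr m ⁻¹' {b} = {ω | ∀ i ≤ m, ω i = a i} := by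
    ext ω
    simp only [Set.mem_preimage, Set.mem_singleton_iff, Set.mem_ofPred_eq, funext_iff]
    constructor
    · intro h i hi
      rw [ha i (by omega)]; exact h ⟨i, by omega⟩
    · intro h i
      rw [← ha i i.2]; exact h i (by omega)
  have h2 : restr m ⁻¹' {b} ∩ {ω | ω (m + 1) = y} = {ω | ∀ i ≤ m + 1, ω i = a i} := by
    rw [h1]
    have hy : a (m + 1) = y := by simp [a]
    ext ω
    simp only [Set.mem_inter_iff, Set.mem_ofPred_eq]
    constructor
    · rintro ⟨h, h'⟩ i hi
      rcases Nat.lt_or_eq_of_le hi with h3 | h3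
      · exact h i (by omega)
      · rw [h3, h', hy]
    · intro h
      exact ⟨fun i hi => h i (by omega), by rw [h (m + 1) le_rfl, hy]⟩
  rw [h2, h1, measureReal_def, measureReal_def, hP, hP, Finset.prod_range_succ, mul_assoc]
  congr 3
  · rw [ha m (by omega)]; rfl
  · simp [a]

lemma one_step
    (hP : ∀ (n : ℕ) (a : ℕ → A),
      (P {ω | ∀ i ≤ n, ω i = a i}).toReal
        = μ (a 0) * ∏ i ∈ Finset.range n, Q (a i) (a (i + 1)))
    {m : ℕ} {S : Set (ℕ → A)} (hS : DepUpTo m S) (x y : A) (hx : ∀ ω ∈ S, ω m = x) :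
    P.real (S ∩ {ω | ω (m + 1) = y}) = P.real S * Q x y := by
  obtain ⟨T, rfl⟩ := hS.exists_preimage
  have hm : ∀ y' ∈ T, MeasurableSet (restr m ⁻¹' {y'}) := fun b _ =>
    measurable_restr m (measurableSet_singleton b)
  have hTm : MeasurableSet (restr (A := A) m ⁻¹' (T : Set (Fin (m + 1) → A))) := hS.measurableSet
  have e1 : P.real (restr m ⁻¹' (T : Set (Fin (m + 1) → A)))
      = ∑ b ∈ T, P.real (restr m ⁻¹' {b}) := by
    rw [sum_measureReal_preimage_singleton T hm]
  have e2 : P.real (restr m ⁻¹' (T : Set (Fin (m + 1) → A)) ∩ {ω | ω (m + 1) = y})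
      = ∑ b ∈ T, P.real (restr m ⁻¹' {b} ∩ {ω | ω (m + 1) = y}) := by
    have := sum_measureReal_preimage_singleton (μ := P.restrict {ω | ω (m + 1) = y}) T hm
    rw [measureReal_restrict_apply hTm] at this
    rw [← this]
    refine Finset.sum_congr rfl fun b hb => ?_
    rw [measureReal_restrict_apply (hm b hb)]
  rw [e1, e2, Finset.sum_mul]
  refine Finset.sum_congr rfl fun b hb => ?_
  rw [cyl_step Q μ P hP]
  have : Nonempty A := ⟨x⟩
  let ω : ℕ → A := fun i => if h : i < m + 1 then b ⟨i, h⟩ else x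
  have hω : restr m ω = b := by
    funext i; exact dif_pos i.2
  have := hx ω (by simp [hω, hb])
  rw [← hω]
  congr 2

/-- Transition weight of the word `a 1 ... a (n+1)`. -/
def wt (Q : A → A → ℝ) (n : ℕ) (a : ℕ → A) : ℝ := ∏ i ∈ Finset.Icc 1 n, Q (a i) (a (i + 1))

lemma matchAt_succ (n : ℕ) (a : ℕ → A) (m : ℕ) :
    matchAt (n + 1) a m = matchAt n a m ∩ {ω | ω (m + n + 1) = a (n + 1)} := by
  ext ω
  simp only [matchAt, Set.mem_inter_iff, Set.mem_ofPred_eq]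
  constructor
  · intro h
    exact ⟨fun i h1 h2 => h i h1 (by omega), h (n + 1) (by omega) le_rfl⟩
  · rintro ⟨h, h'⟩ i h1 h2
    rcases Nat.lt_or_eq_of_le h2 with h3 | h3
    · exact h i h1 (by omega)
    · rw [h3]; exact h'

lemma many_step
    (hP : ∀ (n : ℕ) (a : ℕ → A),
      (P {ω | ∀ i ≤ n, ω i = a i}).toReal
        = μ (a 0) * ∏ i ∈ Finset.range n, Q (a i) (a (i + 1)))
    {m : ℕ} {S : Set (ℕ → A)} (hS : DepUpTo m S) (x : A) (hx : ∀ ω ∈ S, ω m = x)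
    (n : ℕ) (a : ℕ → A) :
    P.real (S ∩ matchAt (n + 1) a m) = P.real S * (Q x (a 1) * wt Q n a) := by
  induction n with
  | zero =>
    have h0 : matchAt 0 a m = Set.univ := by
      ext ω
      simp only [matchAt, Set.mem_ofPred_eq, Set.mem_univ, iff_true]
      intro i h1 h2; omega
    rw [matchAt_succ, h0, Set.univ_inter, Nat.add_zero, one_step Q μ P hP hS x _ hx]
    simp [wt]
  | succ n ih =>
    rw [matchAt_succ, ← Set.inter_assoc]
    rw [show m + (n + 1) + 1 = (m + (n + 1)) + 1 by rfl,
      one_step Q μ P hP ((hS.mono (Nat.le_add_right _ _)).inter (dep_matchAt (n + 1) a m))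
        (a (n + 1)) _ (fun ω hω => hω.2 (n + 1) (by omega) le_rfl), ih]
    unfold wt
    rw [Finset.prod_Icc_succ_top (by omega)]
    ring

/-- Partition according to the value of coordinate `m`. -/
lemma sum_coord {S : Set (ℕ → A)} (hS : MeasurableSet S) (m : ℕ) :
    P.real S = ∑ x, P.real (S ∩ {ω | ω m = x}) := by
  have hm : ∀ x : A, MeasurableSet ((fun ω : ℕ → A => ω m) ⁻¹' {x}) := fun x =>
    (measurable_pi_apply m) (measurableSet_singleton x)
  have := sum_measureReal_preimage_singleton (μ := P.restrict S) (f := fun ω : ℕ → A => ω m)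
    Finset.univ (fun x _ => hm x)
  simp only [Finset.coe_univ, Set.preimage_univ, measureReal_restrict_apply MeasurableSet.univ,
    Set.univ_inter] at this
  rw [← this]
  refine Finset.sum_congr rfl fun x _ => ?_
  rw [measureReal_restrict_apply (hm x), Set.inter_comm]
  rfl

lemma marginal (hstat : ∀ y, ∑ x, μ x * Q x y = μ y)
    (hP : ∀ (n : ℕ) (a : ℕ → A),
      (P {ω | ∀ i ≤ n, ω i = a i}).toReal
        = μ (a 0) * ∏ i ∈ Finset.range n, Q (a i) (a (i + 1)))
    (m : ℕ) (x : A) : P.real {ω | ω m = x} = μ x := by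
  induction m generalizing x with
  | zero =>
    have := hP 0 (fun _ => x)
    simpa [measureReal_def] using this
  | succ m ih =>
    rw [sum_coord P (dep_coord (m + 1) x).measurableSet m, ← hstat x]
    refine Finset.sum_congr rfl fun z _ => ?_
    rw [Set.inter_comm, one_step Q μ P hP (dep_coord m z) z x (fun ω h => h), ih]

lemma prob_match (hstat : ∀ y, ∑ x, μ x * Q x y = μ y)
    (hP : ∀ (n : ℕ) (a : ℕ → A),
      (P {ω | ∀ i ≤ n, ω i = a i}).toReal
        = μ (a 0) * ∏ i ∈ Finset.range n, Q (a i) (a (i + 1)))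
    (n : ℕ) (a : ℕ → A) (m : ℕ) :
    P.real (matchAt (n + 1) a m) = μ (a 1) * wt Q n a := by
  rw [sum_coord P (dep_matchAt (n + 1) a m).measurableSet m, ← hstat (a 1), Finset.sum_mul]
  refine Finset.sum_congr rfl fun z _ => ?_
  rw [Set.inter_comm, many_step Q μ P hP (dep_coord m z) z (fun ω h => h),
    marginal Q μ P hstat hP]
  ring

lemma wt_nonneg (hQ : ∀ x y, 0 < Q x y) (n : ℕ) (a : ℕ → A) : 0 < wt Q n a :=
  Finset.prod_pos fun _ _ => hQ _ _

lemma prob_inter_ge (hQ : ∀ x y, 0 < Q x y)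
    (hP : ∀ (n : ℕ) (a : ℕ → A),
      (P {ω | ∀ i ≤ n, ω i = a i}).toReal
        = μ (a 0) * ∏ i ∈ Finset.range n, Q (a i) (a (i + 1)))
    {c : ℝ} (hc : ∀ x y, c ≤ Q x y)
    {m : ℕ} {S : Set (ℕ → A)} (hS : DepUpTo m S) (n : ℕ) (a : ℕ → A) :
    P.real S * (c * wt Q n a) ≤ P.real (S ∩ matchAt (n + 1) a m) := by
  rw [sum_coord P hS.measurableSet m, sum_coord P (hS.measurableSet.inter
    (dep_matchAt (n + 1) a m).measurableSet) m, Finset.sum_mul]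
  refine Finset.sum_le_sum fun z _ => ?_
  rw [Set.inter_right_comm, many_step Q μ P hP (hS.inter (dep_coord m z)) z (fun ω h => h.2)]
  have := wt_nonneg Q hQ n a
  gcongr
  exact hc _ _

/-- No match in the first `j` blocks. -/
def noMatch (n : ℕ) (a : ℕ → A) (j : ℕ) : Set (ℕ → A) :=
  {y | ∀ l < j, y ∉ matchAt n a (l * n + 1)}

lemma noMatch_succ (n : ℕ) (a : ℕ → A) (j : ℕ) :
    noMatch n a (j + 1) = noMatch n a j \ matchAt n a (j * n + 1) := by
  ext y
  simp only [noMatch, Set.mem_ofPred_eq, Set.mem_sdiff]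
  constructor
  · intro h; exact ⟨fun l hl => h l (by omega), h j (by omega)⟩
  · rintro ⟨h, h'⟩ l hl
    rcases Nat.lt_or_eq_of_le (Nat.le_of_lt_succ hl) with h3 | h3
    · exact h l h3
    · rw [h3]; exact h'

lemma dep_noMatch (n : ℕ) (a : ℕ → A) (j : ℕ) : DepUpTo (j * n + 1) (noMatch n a j) := by
  induction j with
  | zero => 
    intro ω ω' _ _ l hl; omega
  | succ j ih =>
    rw [noMatch_succ, Set.sdiff_eq]
    refine (ih.mono (by nlinarith)).inter ((dep_matchAt n a _).mono ?_).compl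
    nlinarith

lemma prob_noMatch (hQ : ∀ x y, 0 < Q x y)
    (hP : ∀ (n : ℕ) (a : ℕ → A),
      (P {ω | ∀ i ≤ n, ω i = a i}).toReal
        = μ (a 0) * ∏ i ∈ Finset.range n, Q (a i) (a (i + 1)))
    {c : ℝ} (hc : ∀ x y, c ≤ Q x y) (n : ℕ) (a : ℕ → A)
    (h1 : c * wt Q n a ≤ 1) (j : ℕ) :
    P.real (noMatch (n + 1) a j) ≤ (1 - c * wt Q n a) ^ j := by
  induction j with
  | zero => simp
  | succ j ih =>
    have h := prob_inter_ge Q μ P hQ hP hc (dep_noMatch (n + 1) a j) n a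
    have h2 := measureReal_sdiff_add_inter (μ := P) (s := noMatch (n + 1) a j)
      (dep_matchAt (n + 1) a (j * (n + 1) + 1)).measurableSet
    rw [noMatch_succ, pow_succ]
    have : 0 ≤ 1 - c * wt Q n a := by linarith
    nlinarith

lemma log_sq_le_of_one_le {x : ℝ} (hx : 1 ≤ x) : Real.log x ^ 2 ≤ 4 * x := by
  have h0 : 0 ≤ x := by linarith
  have h1 : Real.log (√x) ≤ √x := (Real.log_le_sub_one_of_pos (Real.sqrt_pos.2 (by linarith))).trans
    (by linarith)
  rw [Real.log_sqrt h0] at h1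
  have h2 := Real.log_nonneg hx
  have h3 := Real.sq_sqrt h0
  have h4 := Real.sqrt_nonneg x
  nlinarith

lemma log_sq_le_of_le_one {x : ℝ} (h0 : 0 < x) (hx : x ≤ 1) :
    Real.log x ^ 2 ≤ 16 * (1 / √x) := by
  have h1 : 1 ≤ 1 / √x := by
    rw [le_div_iff₀ (Real.sqrt_pos.2 h0), one_mul]
    exact Real.sqrt_le_one.2 hx
  have h2 := log_sq_le_of_one_le h1
  rw [one_div, Real.log_inv, Real.log_sqrt h0.le] at h2
  rw [one_div]
  nlinarith

lemma log_sq_le_mixed {x n : ℝ} (hx : 1 ≤ x) (hn : 1 ≤ n) :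
    Real.log x ^ 2 ≤ 2 * Real.log n ^ 2 + 8 * (x / n) := by
  have hx0 : 0 < x := by linarith
  have hn0 : 0 < n := by linarith
  rcases le_total 1 (x / n) with h | h
  · have h1 := log_sq_le_of_one_le h
    rw [Real.log_div hx0.ne' hn0.ne'] at h1
    nlinarith [sq_nonneg (Real.log x - 2 * Real.log n)]
  · rw [div_le_one hn0] at h
    have h1 := Real.log_le_log hx0 h
    have h2 := Real.log_nonneg hx
    have : 0 ≤ x / n := by positivity
    nlinarith

lemma sum_inv_sqrt_le (K : ℕ) : ∑ k ∈ Finset.Icc 1 K, 1 / √(k : ℝ) ≤ 2 * √(K : ℝ) := by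
  induction K with
  | zero => simp
  | succ K ih =>
    rw [Finset.sum_Icc_succ_top (by omega)]
    have h1 : 0 < √((K + 1 : ℕ) : ℝ) := Real.sqrt_pos.2 (by positivity)
    have h2 := Real.sq_sqrt (show (0 : ℝ) ≤ ((K + 1 : ℕ) : ℝ) by positivity)
    have h3 := Real.sq_sqrt (show (0 : ℝ) ≤ (K : ℝ) by positivity)
    have h4 := Real.sqrt_nonneg (K : ℝ)
    have h5 : 1 / √((K + 1 : ℕ) : ℝ) ≤ 2 * √((K + 1 : ℕ) : ℝ) - 2 * √(K : ℝ) := by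
      rw [div_le_iff₀ h1]
      push_cast at *
      nlinarith [sq_nonneg (√((K : ℝ) + 1) - √(K : ℝ))]
    linarith

lemma lintegral_prod_le_iterated {α β : Type*} [MeasurableSpace α] [MeasurableSpace β]
    (μ : Measure α) (ν : Measure β) [SFinite ν] (f : α × β → ENNReal) :
    ∫⁻ z, f z ∂(μ.prod ν) ≤ ∫⁻ x, ∫⁻ y, f (x, y) ∂ν ∂μ := by
  obtain ⟨g, hg, hgf, he⟩ := exists_measurable_le_lintegral_eq (μ.prod ν) f
  rw [he, lintegral_prod g hg.aemeasurable]
  exact lintegral_mono fun x => lintegral_mono fun y => hgf (x, y)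

/-- lower-tail majorant -/
noncomputable def lowB (n : ℕ) (a : ℕ → A) (p : ℝ) (y : ℕ → A) : ENNReal :=
  ∑ k ∈ Finset.Icc 1 ⌊1 / p⌋₊,
    ENNReal.ofReal (1 / √(k * p)) * (matchAt n a k).indicator 1 y

/-- number of initial blocks without a match, plus one -/
noncomputable def cntB (n : ℕ) (a : ℕ → A) (y : ℕ → A) : ENNReal :=
  ∑' j : ℕ, (noMatch n a j).indicator 1 y

lemma measurable_lowB (n : ℕ) (a : ℕ → A) (p : ℝ) : Measurable (lowB n a p) := by
  unfold lowB
  refine Finset.measurable_sum _ fun k _ => Measurable.const_mul ?_ _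
  exact measurable_one.indicator (dep_matchAt n a k).measurableSet

lemma measurable_cntB (n : ℕ) (a : ℕ → A) : Measurable (cntB n a) := by
  unfold cntB
  refine Measurable.tsum fun j => ?_
  exact measurable_one.indicator (dep_noMatch n a j).measurableSet

lemma lintegral_lowB (hstat : ∀ y, ∑ x, μ x * Q x y = μ y)
    (hP : ∀ (n : ℕ) (a : ℕ → A),
      (P {ω | ∀ i ≤ n, ω i = a i}).toReal
        = μ (a 0) * ∏ i ∈ Finset.range n, Q (a i) (a (i + 1)))
    (n : ℕ) (a : ℕ → A) (p : ℝ) (hp : p = μ (a 1) * wt Q n a) (hp0 : 0 < p) :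
    ∫⁻ y, lowB (n + 1) a p y ∂P ≤ ENNReal.ofReal 2 := by
  unfold lowB
  rw [lintegral_finsetSum]
  swap
  · intro k _
    exact (measurable_one.indicator (dep_matchAt (n + 1) a k).measurableSet).const_mul _
  have h1 : ∀ k ∈ Finset.Icc 1 ⌊1 / p⌋₊,
      ∫⁻ y, ENNReal.ofReal (1 / √((k : ℝ) * p)) * (matchAt (n + 1) a k).indicator 1 y ∂P
        = ENNReal.ofReal (1 / √((k : ℝ) * p) * p) := by
    intro k _
    rw [lintegral_const_mul _ (measurable_one.indicator (dep_matchAt (n + 1) a k).measurableSet),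
      lintegral_indicator_one (dep_matchAt (n + 1) a k).measurableSet,
      ENNReal.ofReal_mul (by positivity), hp, ← prob_match Q μ P hstat hP n a k,
      ofReal_measureReal]
  rw [Finset.sum_congr rfl h1, ← ENNReal.ofReal_sum_of_nonneg (fun k _ => by positivity)]
  apply ENNReal.ofReal_le_ofReal
  have h2 : ∀ k ∈ Finset.Icc 1 ⌊1 / p⌋₊, 1 / √((k : ℝ) * p) * p = √p * (1 / √(k : ℝ)) := by
    intro k hk
    have hk0 : 0 < √(k : ℝ) := Real.sqrt_pos.2 (by
      have := (Finset.mem_Icc.1 hk).1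
      exact_mod_cast this)
    have hs : 0 < √p := Real.sqrt_pos.2 hp0
    rw [Real.sqrt_mul (by positivity)]
    field_simp
    exact (Real.sq_sqrt hp0.le).symm
  rw [Finset.sum_congr rfl h2, ← Finset.mul_sum]
  have h3 := sum_inv_sqrt_le ⌊1 / p⌋₊
  have h4 : √(⌊1 / p⌋₊ : ℝ) ≤ √(1 / p) := Real.sqrt_le_sqrt (Nat.floor_le (by positivity))
  have h5 : √p * √(1 / p) = 1 := by
    rw [← Real.sqrt_mul hp0.le, mul_one_div_cancel hp0.ne', Real.sqrt_one]
  have h6 := Real.sqrt_nonneg p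
  calc √p * ∑ k ∈ Finset.Icc 1 ⌊1 / p⌋₊, 1 / √(k : ℝ) ≤ √p * (2 * √(1 / p)) := by
        gcongr; linarith
    _ = 2 := by linear_combination 2 * h5

lemma lintegral_cntB (hQ : ∀ x y, 0 < Q x y)
    (hP : ∀ (n : ℕ) (a : ℕ → A),
      (P {ω | ∀ i ≤ n, ω i = a i}).toReal
        = μ (a 0) * ∏ i ∈ Finset.range n, Q (a i) (a (i + 1)))
    {c : ℝ} (hc0 : 0 < c) (hc : ∀ x y, c ≤ Q x y) (n : ℕ) (a : ℕ → A) :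
    ∫⁻ y, cntB (n + 1) a y ∂P ≤ ENNReal.ofReal (1 / (c * wt Q n a)) := by
  have hw := wt_nonneg Q hQ n a
  have hq1 : c * wt Q n a ≤ 1 := by
    have := prob_inter_ge Q μ P hQ hP hc (m := 0) (S := Set.univ) (fun _ _ _ h => h) n a
    have h2 : P.real (Set.univ ∩ matchAt (n + 1) a 0) ≤ 1 := measureReal_le_one
    simp only [probReal_univ, one_mul] at this
    linarith
  have hq0 : 0 < c * wt Q n a := by positivity
  unfold cntB
  rw [lintegral_tsum fun j =>
    (measurable_one.indicator (dep_noMatch (n + 1) a j).measurableSet).aemeasurable]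
  have h1 : ∀ j, ∫⁻ y, (noMatch (n + 1) a j).indicator 1 y ∂P
      ≤ ENNReal.ofReal ((1 - c * wt Q n a) ^ j) := by
    intro j
    rw [lintegral_indicator_one (dep_noMatch (n + 1) a j).measurableSet, ← ofReal_measureReal]
    exact ENNReal.ofReal_le_ofReal (prob_noMatch Q μ P hQ hP hc n a hq1 j)
  refine (ENNReal.tsum_le_tsum h1).trans ?_
  rw [← ENNReal.ofReal_tsum_of_nonneg (fun j => pow_nonneg (by linarith) j)
    (summable_geometric_of_lt_one (by linarith) (by linarith)),
    tsum_geometric_of_lt_one (by linarith) (by linarith)]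
  simp

lemma mem_of_waitingTime_ne_zero {n : ℕ} {a y : ℕ → A} (h : waitingTime n a y ≠ 0) :
    y ∈ matchAt n a (waitingTime n a y) := by
  have hne : {k | 1 ≤ k ∧ ∀ i, 1 ≤ i → i ≤ n → y (k + i) = a i}.Nonempty := by
    by_contra hcon
    rw [Set.not_nonempty_iff_eq_empty] at hcon
    exact h (by rw [waitingTime, hcon, Nat.sInf_empty])
  exact (Nat.sInf_mem hne).2

lemma not_mem_of_waitingTime_eq_zero {n : ℕ} {a y : ℕ → A} (h : waitingTime n a y = 0)
    (k : ℕ) (hk : 1 ≤ k) : y ∉ matchAt n a k := by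
  intro hm
  have := Nat.sInf_mem (s := {k | 1 ≤ k ∧ ∀ i, 1 ≤ i → i ≤ n → y (k + i) = a i}) ⟨k, hk, hm⟩
  have h1 : 1 ≤ waitingTime n a y := this.1
  omega

lemma not_mem_of_lt {n : ℕ} {a y : ℕ → A} 
    (k : ℕ) (hk : 1 ≤ k) (h : k < waitingTime n a y) : y ∉ matchAt n a k := by
  intro hm
  exact Nat.notMem_of_lt_sInf h ⟨hk, hm⟩

lemma cntB_eq_top {n : ℕ} {a y : ℕ → A} (h : waitingTime n a y = 0) : cntB n a y = ⊤ := by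
  unfold cntB
  have : ∀ j, (noMatch n a j).indicator (1 : (ℕ → A) → ENNReal) y = 1 := fun j =>
    Set.indicator_of_mem (show y ∈ noMatch n a j from
      fun l _ => not_mem_of_waitingTime_eq_zero h _ (by omega)) _
  simp_rw [this]
  exact ENNReal.tsum_const_eq_top_of_ne_zero one_ne_zero

lemma le_cntB (n : ℕ) {a y : ℕ → A} (h : waitingTime (n + 1) a y ≠ 0) :
    ENNReal.ofReal ((waitingTime (n + 1) a y : ℝ) / (n + 1 : ℕ)) ≤ cntB (n + 1) a y := by
  set W := waitingTime (n + 1) a y with hW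
  set J := (W - 1) / (n + 1) + 1 with hJ
  have hJ1 : (W - 1) / (n + 1) * (n + 1) ≤ W - 1 := Nat.div_mul_le_self _ _
  have hJ2 : W ≤ J * (n + 1) := by
    have h3 := Nat.lt_mul_of_div_lt (Nat.lt_succ_self ((W - 1) / (n + 1))) (Nat.succ_pos n)
    rw [hJ]
    have h4 : W - 1 < ((W - 1) / (n + 1) + 1) * (n + 1) := by
      simpa [Nat.succ_eq_add_one, mul_comm] using h3
    omega
  have h1 : (J : ENNReal) ≤ cntB (n + 1) a y := by
    have : ∀ j ∈ Finset.range J,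
        (noMatch (n + 1) a j).indicator (1 : (ℕ → A) → ENNReal) y = 1 := by
      intro j hj
      refine Set.indicator_of_mem (show y ∈ noMatch (n + 1) a j from
        fun l hl => not_mem_of_lt _ (by omega) ?_) _
      rw [← hW]
      have hj' := Finset.mem_range.1 hj
      have : (l + 1) * (n + 1) ≤ (W - 1) / (n + 1) * (n + 1) :=
        Nat.mul_le_mul_right _ (by omega)
      have h5 : (l + 1) * (n + 1) = l * (n + 1) + n + 1 := by ring
      omega
    have h2 := ENNReal.sum_le_tsum (f := fun j =>
      (noMatch (n + 1) a j).indicator (1 : (ℕ → A) → ENNReal) y) (Finset.range J)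
    rw [Finset.sum_congr rfl this] at h2
    simpa [cntB] using h2
  refine le_trans ?_ h1
  rw [← ENNReal.ofReal_natCast]
  apply ENNReal.ofReal_le_ofReal
  rw [div_le_iff₀ (by positivity)]
  exact_mod_cast hJ2

lemma exists_majorant (hQ : ∀ x y, 0 < Q x y)
    (hstat : ∀ y, ∑ x, μ x * Q x y = μ y) (hμ : ∀ x, 0 < μ x)
    (hP : ∀ (n : ℕ) (a : ℕ → A),
      (P {ω | ∀ i ≤ n, ω i = a i}).toReal
        = μ (a 0) * ∏ i ∈ Finset.range n, Q (a i) (a (i + 1)))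
    {c : ℝ} (hc0 : 0 < c) (hc : ∀ x y, c ≤ Q x y) (n : ℕ) (a : ℕ → A) :
    ∃ B : (ℕ → A) → ENNReal, Measurable B ∧
      ∫⁻ y, B y ∂P ≤ ENNReal.ofReal (2 * Real.log (n + 1 : ℕ) ^ 2 + 32 + 8 / c) ∧
      ∀ y, (waitingTime (n + 1) a y = 0 → B y = ⊤) ∧
        ENNReal.ofReal (Real.log (waitingTime (n + 1) a y * (μ (a 1) * wt Q n a)) ^ 2) ≤ B y := by
  have hw := wt_nonneg Q hQ n a
  have hμ1 : μ (a 1) ≤ 1 := by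
    rw [← marginal Q μ P hstat hP 0 (a 1)]; exact measureReal_le_one
  have hμ0 := hμ (a 1)
  obtain ⟨p, hp⟩ : ∃ p, p = μ (a 1) * wt Q n a := ⟨_, rfl⟩
  have hp0 : 0 < p := by rw [hp]; positivity
  have hlow := lintegral_lowB Q μ P hstat hP n a p hp hp0
  have hcnt := lintegral_cntB Q μ P hQ hP hc0 hc n a
  rw [← hp]
  refine ⟨fun y => ENNReal.ofReal (2 * Real.log (n + 1 : ℕ) ^ 2)
    + (ENNReal.ofReal 16 * lowB (n + 1) a p y + ENNReal.ofReal (8 * p) * cntB (n + 1) a y),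
    ?_, ?_, ?_⟩
  · exact measurable_const.add (((measurable_lowB _ _ _).const_mul _).add
      ((measurable_cntB _ _).const_mul _))
  · rw [lintegral_add_left measurable_const,
      lintegral_add_left ((measurable_lowB _ _ _).const_mul _),
      lintegral_const_mul _ (measurable_lowB _ _ _), lintegral_const_mul _ (measurable_cntB _ _),
      lintegral_const, measure_univ, mul_one, add_assoc, ENNReal.ofReal_add (by positivity)
        (by positivity), ENNReal.ofReal_add (by positivity) (by positivity)]
    gcongr
    · calc ENNReal.ofReal 16 * ∫⁻ y, lowB (n + 1) a p y ∂P
          ≤ ENNReal.ofReal 16 * ENNReal.ofReal 2 := by gcongr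
        _ = ENNReal.ofReal 32 := by
          rw [← ENNReal.ofReal_mul (by norm_num)]; norm_num
    · calc ENNReal.ofReal (8 * p) * ∫⁻ y, cntB (n + 1) a y ∂P
          ≤ ENNReal.ofReal (8 * p) * ENNReal.ofReal (1 / (c * wt Q n a)) := by gcongr
        _ ≤ ENNReal.ofReal (8 / c) := by
          rw [← ENNReal.ofReal_mul (by positivity)]
          apply ENNReal.ofReal_le_ofReal
          have : 8 * p * (1 / (c * wt Q n a)) = μ (a 1) * (8 / c) := by
            rw [hp]; field_simp
          rw [this]
          have : 0 < 8 / c := by positivity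
          nlinarith
  · intro y
    have htop : waitingTime (n + 1) a y = 0 → ENNReal.ofReal (2 * Real.log (n + 1 : ℕ) ^ 2)
        + (ENNReal.ofReal 16 * lowB (n + 1) a p y + ENNReal.ofReal (8 * p) * cntB (n + 1) a y)
        = ⊤ := by
      intro h
      rw [cntB_eq_top h, ENNReal.mul_top (by
        rw [Ne, ENNReal.ofReal_eq_zero, not_le]; positivity)]
      simp
    refine ⟨htop, ?_⟩
    by_cases h : waitingTime (n + 1) a y = 0
    · show _ ≤ _ + _
      rw [htop h]; exact le_top
    have hW1 : 1 ≤ waitingTime (n + 1) a y := Nat.one_le_iff_ne_zero.2 h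
    have hmem := mem_of_waitingTime_ne_zero h
    have hcn := le_cntB n h
    set W := waitingTime (n + 1) a y with hW
    have hWr : (0 : ℝ) < W := by exact_mod_cast hW1
    have hx0 : 0 < (W : ℝ) * p := by positivity
    rcases le_total ((W : ℝ) * p) 1 with hx | hx
    · have hK : W ∈ Finset.Icc 1 ⌊1 / p⌋₊ := by
        rw [Finset.mem_Icc]
        refine ⟨hW1, Nat.le_floor ?_⟩
        rwa [le_div_iff₀ hp0]
      have h1 : ENNReal.ofReal (1 / √(W * p)) ≤ lowB (n + 1) a p y := by
        unfold lowB
        refine le_trans ?_ (Finset.single_le_sum (fun _ _ => zero_le) hK)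
        rw [Set.indicator_of_mem hmem]
        simp
      calc ENNReal.ofReal (Real.log (W * p) ^ 2)
          ≤ ENNReal.ofReal (16 * (1 / √(W * p))) :=
            ENNReal.ofReal_le_ofReal (log_sq_le_of_le_one hx0 hx)
        _ = ENNReal.ofReal 16 * ENNReal.ofReal (1 / √(W * p)) := ENNReal.ofReal_mul (by norm_num)
        _ ≤ ENNReal.ofReal 16 * lowB (n + 1) a p y := by gcongr
        _ ≤ _ := le_trans le_self_add le_add_self
    · have hn1 : (1 : ℝ) ≤ (n + 1 : ℕ) := by exact_mod_cast Nat.le_add_left 1 n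
      calc ENNReal.ofReal (Real.log (W * p) ^ 2)
          ≤ ENNReal.ofReal (2 * Real.log (n + 1 : ℕ) ^ 2 + 8 * (W * p / (n + 1 : ℕ))) :=
            ENNReal.ofReal_le_ofReal (log_sq_le_mixed hx hn1)
        _ = ENNReal.ofReal (2 * Real.log (n + 1 : ℕ) ^ 2)
            + ENNReal.ofReal (8 * p) * ENNReal.ofReal (W / (n + 1 : ℕ)) := by
            rw [ENNReal.ofReal_add (by positivity) (by positivity),
              ← ENNReal.ofReal_mul (by positivity)]
            congr 2; ring
        _ ≤ ENNReal.ofReal (2 * Real.log (n + 1 : ℕ) ^ 2)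
            + ENNReal.ofReal (8 * p) * cntB (n + 1) a y := by gcongr
        _ ≤ _ := add_le_add le_rfl le_add_self

end helpers

/-- Sum of logs of ratios as a difference of log weights. -/
lemma sum_log_ratio {A : Type*} (QX QY : A → A → ℝ) (hX : ∀ x y, 0 < QX x y)
    (hY : ∀ x y, 0 < QY x y) (n : ℕ) (a : ℕ → A) :
    ∑ i ∈ Finset.Icc 1 n, Real.log (QX (a i) (a (i + 1)) / QY (a i) (a (i + 1)))
      = Real.log (wt QX n a) - Real.log (wt QY n a) := by
  unfold wt
  rw [Real.log_prod (fun i _ => (hX _ _).ne'), Real.log_prod (fun i _ => (hY _ _).ne'),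
    ← Finset.sum_sub_distrib]
  exact Finset.sum_congr rfl fun i _ => Real.log_div (hX _ _).ne' (hY _ _).ne'

lemma exists_lower {A : Type*} [Fintype A] [Nonempty A] (Q : A → A → ℝ) (hQ : ∀ x y, 0 < Q x y) :
    ∃ c : ℝ, 0 < c ∧ ∀ x y, c ≤ Q x y := by
  obtain ⟨z, hz⟩ := Finite.exists_min (fun z : A × A => Q z.1 z.2)
  exact ⟨Q z.1 z.2, hQ _ _, fun x y => hz (x, y)⟩

lemma stat_pos {A : Type*} [Fintype A] (Q : A → A → ℝ) (μ : A → ℝ)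
    (h0 : ∀ x, 0 ≤ μ x) (h1 : ∑ x, μ x = 1) (hstat : ∀ y, ∑ x, μ x * Q x y = μ y)
    {c : ℝ} (hc0 : 0 < c) (hc : ∀ x y, c ≤ Q x y) (y : A) : 0 < μ y := by
  have : c ≤ μ y := by
    rw [← hstat y]
    calc c = ∑ x, μ x * c := by rw [← Finset.sum_mul, h1, one_mul]
      _ ≤ _ := Finset.sum_le_sum fun x _ => mul_le_mul_of_nonneg_left (hc x y) (h0 x)
  linarith

lemma sq_three (u v w : ℝ) : (u - v + w) ^ 2 ≤ 3 * (u ^ 2 + v ^ 2 + w ^ 2) := by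
  nlinarith [sq_nonneg (u + v), sq_nonneg (u - w), sq_nonneg (v + w)]

/-- `L²` approximation of `log(W_n(X|Y)/W_n(X|X'))` by the ergodic sum
`∑_{i=1}^{n-1} log (Q_X(X_i,X_{i+1})/Q_Y(X_i,X_{i+1}))`. -/
theorem stmt12
    {A : Type*} [Fintype A] [Nonempty A] [MeasurableSpace A] [MeasurableSingletonClass A]
    (QX QY : A → A → ℝ) (μ μt : A → ℝ)
    (hQXpos : ∀ x y, 0 < QX x y) (hQXrow : ∀ x, ∑ y, QX x y = 1)
    (hQYpos : ∀ x y, 0 < QY x y) (hQYrow : ∀ x, ∑ y, QY x y = 1)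
    (hμnonneg : ∀ x, 0 ≤ μ x) (hμsum : ∑ x, μ x = 1)
    (hμstat : ∀ y, ∑ x, μ x * QX x y = μ y)
    (hμtnonneg : ∀ x, 0 ≤ μt x) (hμtsum : ∑ x, μt x = 1)
    (hμtstat : ∀ y, ∑ x, μt x * QY x y = μt y)
    (P Pt : Measure (ℕ → A)) [IsProbabilityMeasure P] [IsProbabilityMeasure Pt]
    (hP : ∀ (n : ℕ) (a : ℕ → A),
      (P {ω | ∀ i ≤ n, ω i = a i}).toReal
        = μ (a 0) * ∏ i ∈ Finset.range n, QX (a i) (a (i + 1)))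
    (hPt : ∀ (n : ℕ) (a : ℕ → A),
      (Pt {ω | ∀ i ≤ n, ω i = a i}).toReal
        = μt (a 0) * ∏ i ∈ Finset.range n, QY (a i) (a (i + 1))) :
    Tendsto (fun n : ℕ =>
        (∫ z, (Real.log ((waitingTime n z.1.1 z.1.2 : ℝ) / (waitingTime n z.1.1 z.2 : ℝ))
            - ∑ i ∈ Finset.Icc 1 (n - 1),
                Real.log (QX (z.1.1 i) (z.1.1 (i + 1)) / QY (z.1.1 i) (z.1.1 (i + 1)))) ^ 2
          ∂((P.prod Pt).prod P)) / n)
      atTop (nhds 0) := by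
  obtain ⟨c, hc0, hc⟩ := exists_lower QX hQXpos
  obtain ⟨d, hd0, hd⟩ := exists_lower QY hQYpos
  have hμ := stat_pos QX μ hμnonneg hμsum hμstat hc0 hc
  have hμt := stat_pos QY μt hμtnonneg hμtsum hμtstat hd0 hd
  obtain ⟨C, hC0, hC⟩ : ∃ C : ℝ, 0 ≤ C ∧ ∀ x, (Real.log (μ x) - Real.log (μt x)) ^ 2 ≤ C :=
    ⟨∑ x, (Real.log (μ x) - Real.log (μt x)) ^ 2, Finset.sum_nonneg fun _ _ => sq_nonneg _,
      fun x => Finset.single_le_sum (f := fun x => (Real.log (μ x) - Real.log (μt x)) ^ 2)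
        (fun _ _ => sq_nonneg _) (Finset.mem_univ x)⟩
  set F : ℕ → ((ℕ → A) × (ℕ → A)) × (ℕ → A) → ℝ := fun n z =>
    (Real.log ((waitingTime n z.1.1 z.1.2 : ℝ) / (waitingTime n z.1.1 z.2 : ℝ))
            - ∑ i ∈ Finset.Icc 1 (n - 1),
                Real.log (QX (z.1.1 i) (z.1.1 (i + 1)) / QY (z.1.1 i) (z.1.1 (i + 1)))) ^ 2 with hF
  have hbound : ∀ n : ℕ, 1 ≤ n → ∫ z, F n z ∂((P.prod Pt).prod P)
      ≤ 3 * ((2 * Real.log n ^ 2 + 32 + 8 / d) + (2 * Real.log n ^ 2 + 32 + 8 / c) + C) := by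
    intro n hn
    obtain ⟨m, rfl⟩ : ∃ m, n = m + 1 := ⟨n - 1, by omega⟩
    set bX : ℝ := 2 * Real.log (m + 1 : ℕ) ^ 2 + 32 + 8 / c with hbX
    set bY : ℝ := 2 * Real.log (m + 1 : ℕ) ^ 2 + 32 + 8 / d with hbY
    have hbX0 : 0 ≤ bX := by positivity
    have hbY0 : 0 ≤ bY := by positivity
    choose BX hBXm hBXi hBX using
      exists_majorant QX μ P hQXpos hμstat hμ hP hc0 hc m
    choose BY hBYm hBYi hBY using
      exists_majorant QY μt Pt hQYpos hμtstat hμt hPt hd0 hd m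
    have hpt : ∀ z, ‖F (m + 1) z‖ₑ
        ≤ 3 * (BY z.1.1 z.1.2 + ENNReal.ofReal C + BX z.1.1 z.2) := by
      rintro ⟨⟨x, y⟩, x'⟩
      obtain ⟨hY0, hY1⟩ := hBY x y
      obtain ⟨hX0, hX1⟩ := hBX x x'
      by_cases h1 : waitingTime (m + 1) x y = 0
      · simp [hY0 h1]
      by_cases h2 : waitingTime (m + 1) x x' = 0
      · simp [hX0 h2]
      have h1' : (waitingTime (m + 1) x y : ℝ) ≠ 0 := by exact_mod_cast h1
      have h2' : (waitingTime (m + 1) x x' : ℝ) ≠ 0 := by exact_mod_cast h2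
      have hwX := (wt_nonneg QX hQXpos m x).ne'
      have hwY := (wt_nonneg QY hQYpos m x).ne'
      have hle : F (m + 1) ((x, y), x') ≤ 3 * (
          Real.log (waitingTime (m + 1) x y * (μt (x 1) * wt QY m x)) ^ 2
          + C + Real.log (waitingTime (m + 1) x x' * (μ (x 1) * wt QX m x)) ^ 2) := by
        have heq : F (m + 1) ((x, y), x') =
          (Real.log (waitingTime (m + 1) x y * (μt (x 1) * wt QY m x))
          - Real.log (waitingTime (m + 1) x x' * (μ (x 1) * wt QX m x))
          + (Real.log (μ (x 1)) - Real.log (μt (x 1)))) ^ 2 := by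
          simp only [hF, Nat.add_sub_cancel]
          rw [sum_log_ratio QX QY hQXpos hQYpos m x, Real.log_div h1' h2',
            Real.log_mul h1' (mul_ne_zero (hμt _).ne' hwY), Real.log_mul (hμt _).ne' hwY,
            Real.log_mul h2' (mul_ne_zero (hμ _).ne' hwX), Real.log_mul (hμ _).ne' hwX]
          ring
        rw [heq]
        refine (sq_three _ _ _).trans ?_
        have := hC (x 1)
        linarith
      have hF0 : 0 ≤ F (m + 1) ((x, y), x') := sq_nonneg _
      rw [Real.enorm_eq_ofReal hF0]
      refine (ENNReal.ofReal_le_ofReal hle).trans ?_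
      rw [ENNReal.ofReal_mul (by norm_num), ENNReal.ofReal_add (by positivity) (by positivity),
        ENNReal.ofReal_add (by positivity) (by positivity)]
      simp only [ENNReal.ofReal_ofNat]
      gcongr
    have hlin : ∫⁻ z, ‖F (m + 1) z‖ₑ ∂((P.prod Pt).prod P)
        ≤ ENNReal.ofReal (3 * (bY + bX + C)) := by
      calc ∫⁻ z, ‖F (m + 1) z‖ₑ ∂((P.prod Pt).prod P)
          ≤ ∫⁻ z, 3 * (BY z.1.1 z.1.2 + ENNReal.ofReal C + BX z.1.1 z.2)
              ∂((P.prod Pt).prod P) := lintegral_mono hpt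
        _ ≤ ∫⁻ w, ∫⁻ x', 3 * (BY w.1 w.2 + ENNReal.ofReal C + BX w.1 x') ∂P ∂(P.prod Pt) :=
            lintegral_prod_le_iterated _ _ _
        _ ≤ ∫⁻ w, 3 * (ENNReal.ofReal C + ENNReal.ofReal bX + BY w.1 w.2) ∂(P.prod Pt) := by
            refine lintegral_mono fun w => ?_
            rw [lintegral_const_mul' _ _ (by norm_num),
              lintegral_add_left measurable_const, lintegral_const, measure_univ, mul_one]
            have := hBXi w.1
            calc 3 * (BY w.1 w.2 + ENNReal.ofReal C + ∫⁻ y, BX w.1 y ∂P)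
                ≤ 3 * (BY w.1 w.2 + ENNReal.ofReal C + ENNReal.ofReal bX) := by gcongr
              _ = _ := by ring
        _ ≤ ∫⁻ x, ∫⁻ y, 3 * (ENNReal.ofReal C + ENNReal.ofReal bX + BY x y) ∂Pt ∂P :=
            lintegral_prod_le_iterated _ _ _
        _ ≤ ∫⁻ x, 3 * (ENNReal.ofReal C + ENNReal.ofReal bX + ENNReal.ofReal bY) ∂P := by
            refine lintegral_mono fun x => ?_
            rw [lintegral_const_mul' _ _ (by norm_num),
              lintegral_add_left measurable_const, lintegral_const, measure_univ, mul_one]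
            have := hBYi x
            gcongr
        _ = ENNReal.ofReal (3 * (bY + bX + C)) := by
            rw [lintegral_const, measure_univ, mul_one, ENNReal.ofReal_mul (by norm_num),
              ENNReal.ofReal_add (by positivity) hC0, ENNReal.ofReal_add hbY0 hbX0]
            simp only [ENNReal.ofReal_ofNat]
            ring
    have hfin := (enorm_integral_le_lintegral_enorm (F (m + 1))).trans hlin
    rw [Real.enorm_eq_ofReal (integral_nonneg fun z => sq_nonneg _),
      ENNReal.ofReal_le_ofReal_iff (by positivity)] at hfin
    exact hfin
  have hlim : Tendsto (fun n : ℕ => 12 * (Real.log (n : ℝ) ^ 2 / (n : ℝ))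
      + (3 * (64 + 8 / d + 8 / c + C)) / (n : ℝ)) atTop (nhds 0) := by
    have h1 : Tendsto (fun x : ℝ => Real.log x ^ 2 / x) atTop (nhds 0) :=
      (Real.isLittleO_pow_log_id_atTop (n := 2)).tendsto_div_nhds_zero
    have h2 := (h1.comp tendsto_natCast_atTop_atTop).const_mul (12 : ℝ)
    have h3 := tendsto_const_div_atTop_nhds_zero_nat (3 * (64 + 8 / d + 8 / c + C))
    simpa using! h2.add h3
  refine squeeze_zero' (Eventually.of_forall fun n => ?_) ?_ hlim
  · exact div_nonneg (integral_nonneg fun z => sq_nonneg _) (Nat.cast_nonneg n)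
  · filter_upwards [eventually_ge_atTop 1] with n hn
    have hn0 : (0 : ℝ) < n := by exact_mod_cast hn
    have := hbound n hn
    rw [← mul_div_assoc, ← add_div]
    refine div_le_div_of_nonneg_right (this.trans (le_of_eq (by ring))) hn0.le
end

section
/- Let A be a nonempty finite set, let Q_X and Q_Y be strictly positive stochastic matrices on A with stationary probability vectors mu and mu~, and let P, P~ be the stationary Markov measures determined by (Q_X, mu) and (Q_Y, mu~). Then for every fixed sequence g in A^N, for (P tensor P~)-almost every (omega, omega'): lim_{n->infinity} (1/n) [ log T_n(g | omega') - log T_n(g | omega) - sum_{i=1}^{n-1} log( Q_X(g_i, g_{i+1}) / Q_Y(g_i, g_{i+1}) ) ] = 0, where omega is distributed according to P (the Q_X-chain) and omega' according to P~ (the Q_Y-chain). -/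
open MeasureTheory Filter Finset Real

/-- Hitting time of the first `n` symbols of a fixed target sequence `g`:
`T_n(g|ω) = inf { k ≥ 0 : ω_{k+i} = g_i for all 1 ≤ i ≤ n }`. -/
noncomputable def hitTime {A : Type*} (n : ℕ) (g ω : ℕ → A) : ℕ :=
  sInf {k | ∀ i, 1 ≤ i → i ≤ n → ω (k + i) = g i}

namespace Shadow

variable {A : Type*}

def mt (g : ℕ → A) (n k : ℕ) : Set (ℕ → A) :=
  {ω | ∀ i, 1 ≤ i → i ≤ n → ω (k + i) = g i}

def pr (Q : A → A → ℝ) (g : ℕ → A) (m : ℕ) : ℝ :=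
  ∏ i ∈ Finset.range m, Q (g (i + 1)) (g (i + 2))

lemma mt_meas [MeasurableSpace A] [MeasurableSingletonClass A] (g : ℕ → A) (n k : ℕ) :
    MeasurableSet (mt g n k) := by
  have : mt g n k = ⋂ i, ⋂ (_ : 1 ≤ i), ⋂ (_ : i ≤ n), (fun ω : ℕ → A => ω (k + i)) ⁻¹' {g i} := by
    ext ω; simp [mt]
  rw [this]
  exact MeasurableSet.iInter fun i => MeasurableSet.iInter fun _ => MeasurableSet.iInter fun _ =>
    (measurable_pi_apply (k + i)) (measurableSet_singleton _)

lemma cyl [MeasurableSpace A] (Q : A → A → ℝ) (μ : A → ℝ) (P : Measure (ℕ → A))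
    (hP : ∀ (n : ℕ) (a : ℕ → A),
      (P {ω | ∀ i ≤ n, ω i = a i}).toReal
        = μ (a 0) * ∏ i ∈ Finset.range n, Q (a i) (a (i + 1)))
    (g a : ℕ → A) (m k : ℕ) :
    P.real ({ω | ∀ i ≤ k, ω i = a i} ∩ mt g (m + 1) k)
      = P.real {ω | ∀ i ≤ k, ω i = a i} * (Q (a k) (g 1) * pr Q g m) := by
  let b : ℕ → A := fun i => if i ≤ k then a i else g (i - k)
  have hb1 : ∀ i, i ≤ k → b i = a i := fun i hi => by simp [b, hi]
  have hb2 : ∀ i, 1 ≤ i → b (k + i) = g i := fun i hi => by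
    have : ¬ (k + i ≤ k) := by omega
    simp only [b, if_neg this]
    congr 1; omega
  have hset : ({ω | ∀ i ≤ k, ω i = a i} ∩ mt g (m + 1) k) = {ω | ∀ i ≤ k + (m + 1), ω i = b i} := by
    ext ω
    simp only [mt, Set.mem_inter_iff, Set.mem_ofPred_eq]
    constructor
    · rintro ⟨h1, h2⟩ i hi
      by_cases h : i ≤ k
      · rw [hb1 i h, h1 i h]
      · obtain ⟨j, rfl⟩ := Nat.exists_eq_add_of_lt (not_le.mp h)
        have := hb2 (j + 1) (by omega)
        rw [add_assoc, this]
        exact h2 _ (by omega) (by omega)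
    · intro h
      refine ⟨fun i hi => by rw [h i (by omega), hb1 i hi], fun i h1 h2 => ?_⟩
      rw [h _ (by omega), hb2 i h1]
  rw [hset, Measure.real, Measure.real, hP, hP, Finset.prod_range_add, Finset.prod_range_succ']
  have e1 : ∏ i ∈ Finset.range k, Q (b i) (b (i + 1)) = ∏ i ∈ Finset.range k, Q (a i) (a (i + 1)) := by
    refine Finset.prod_congr rfl fun i hi => ?_
    have := Finset.mem_range.mp hi
    rw [hb1 i (by omega), hb1 (i + 1) (by omega)]
  have e2 : ∏ i ∈ Finset.range m, Q (b (k + (i + 1))) (b (k + (i + 1) + 1)) = pr Q g m := by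
    refine Finset.prod_congr rfl fun i hi => ?_
    rw [hb2 _ (by omega), add_assoc k, hb2 _ (by omega)]
  rw [e1, e2, hb1 0 (by omega), add_zero, hb1 k le_rfl, hb2 1 le_rfl]
  ring

lemma pr_pos (Q : A → A → ℝ) (hQ : ∀ x y, 0 < Q x y) (g : ℕ → A) (m : ℕ) : 0 < pr Q g m :=
  Finset.prod_pos fun _ _ => hQ _ _

lemma sandwich [Fintype A] [MeasurableSpace A] [MeasurableSingletonClass A]
    (Q : A → A → ℝ) (μ : A → ℝ) (P : Measure (ℕ → A)) [IsProbabilityMeasure P]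
    (hQpos : ∀ x y, 0 < Q x y)
    (hP : ∀ (n : ℕ) (a : ℕ → A),
      (P {ω | ∀ i ≤ n, ω i = a i}).toReal
        = μ (a 0) * ∏ i ∈ Finset.range n, Q (a i) (a (i + 1)))
    (c : ℝ) (hc : ∀ x y, c ≤ Q x y) (hQ1 : ∀ x y, Q x y ≤ 1)
    (g : ℕ → A) (m k : ℕ) (E : Set (ℕ → A))
    (hE : ∀ ω ω' : ℕ → A, (∀ i ≤ k, ω i = ω' i) → ω ∈ E → ω' ∈ E) :
    MeasurableSet E ∧
    c * pr Q g m * P.real E ≤ P.real (E ∩ mt g (m + 1) k) ∧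
    P.real (E ∩ mt g (m + 1) k) ≤ pr Q g m * P.real E := by
  classical
  let r : (ℕ → A) → (Fin (k + 1) → A) := fun ω i => ω i
  have hr : Measurable r := measurable_pi_lambda _ fun i => measurable_pi_apply _
  let S : Finset (Fin (k + 1) → A) := Finset.univ.filter (fun a => a ∈ r '' E)
  have hES : E = r ⁻¹' (S : Set (Fin (k + 1) → A)) := by
    ext ω
    simp only [S, Finset.coe_filter, Finset.mem_univ, true_and, Set.mem_preimage, Set.mem_ofPred_eq]
    constructor
    · exact fun h => ⟨ω, h, rfl⟩
    · rintro ⟨ω', h', h⟩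
      exact hE ω' ω (fun i hi => congrFun h ⟨i, by omega⟩) h'
  have hEm : MeasurableSet E := by
    rw [hES]; exact hr (S.measurableSet)
  have hsum : ∀ F : Set (ℕ → A), P.real (E ∩ F) = ∑ a ∈ S, P.real (r ⁻¹' {a} ∩ F) := by
    intro F
    have h := sum_measure_preimage_singleton (μ := P.restrict F) S (f := r)
      (fun a _ => hr (measurableSet_singleton a))
    rw [← hES, Measure.restrict_apply hEm] at h
    rw [Measure.real, ← h, ENNReal.toReal_sum (fun _ _ => measure_ne_top _ _)]
    refine Finset.sum_congr rfl fun a _ => ?_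
    rw [Measure.restrict_apply (hr (measurableSet_singleton a)), Measure.real]
  have h0 := hsum Set.univ
  simp only [Set.inter_univ] at h0
  have hterm : ∀ a ∈ S, ∃ x, P.real (r ⁻¹' {a} ∩ mt g (m + 1) k)
      = P.real (r ⁻¹' {a}) * (Q x (g 1) * pr Q g m) := by
    intro a ha
    obtain ⟨ω0, -, h0⟩ : a ∈ r '' E := by simpa [S] using ha
    refine ⟨ω0 k, ?_⟩
    have : r ⁻¹' {a} = {ω | ∀ i ≤ k, ω i = ω0 i} := by
      ext ω
      simp only [Set.mem_preimage, Set.mem_singleton_iff, ← h0, Set.mem_ofPred_eq]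
      constructor
      · intro h i hi
        exact congrFun h ⟨i, by omega⟩
      · intro h; funext i; exact h i (by omega)
    rw [this]
    exact cyl Q μ P hP g ω0 m k
  have hp := pr_pos Q hQpos g m
  refine ⟨hEm, ?_, ?_⟩
  · rw [hsum, h0, Finset.mul_sum]
    refine Finset.sum_le_sum fun a ha => ?_
    obtain ⟨x, hx⟩ := hterm a ha
    rw [hx, mul_comm]
    gcongr
    exact hc _ _
  · rw [hsum, h0, Finset.mul_sum]
    refine Finset.sum_le_sum fun a ha => ?_
    obtain ⟨x, hx⟩ := hterm a ha
    rw [hx, mul_comm]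
    gcongr
    exact mul_le_of_le_one_left hp.le (hQ1 _ _)

def noHit (g : ℕ → A) (m M : ℕ) : Set (ℕ → A) :=
  {ω | ∀ j < M, ω ∉ mt g (m + 1) (j * (m + 1))}

lemma noHit_bound [Fintype A] [MeasurableSpace A] [MeasurableSingletonClass A]
    (Q : A → A → ℝ) (μ : A → ℝ) (P : Measure (ℕ → A)) [IsProbabilityMeasure P]
    (hQpos : ∀ x y, 0 < Q x y)
    (hP : ∀ (n : ℕ) (a : ℕ → A),
      (P {ω | ∀ i ≤ n, ω i = a i}).toReal
        = μ (a 0) * ∏ i ∈ Finset.range n, Q (a i) (a (i + 1)))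
    (c : ℝ) (hc : ∀ x y, c ≤ Q x y) (hQ1 : ∀ x y, Q x y ≤ 1)
    (g : ℕ → A) (m M : ℕ) :
    P.real (noHit g m M) ≤ Real.exp (- (c * pr Q g m * M)) := by
  induction M with
  | zero => simp
  | succ M ih =>
    obtain ⟨hm, h1, -⟩ := sandwich Q μ P hQpos hP c hc hQ1 g m (M * (m + 1)) (noHit g m M) (by
      intro ω ω' h hω j hj hmem
      refine hω j hj fun i h1 h2 => ?_
      rw [h _ ?_]
      · exact hmem i h1 h2
      · calc j * (m + 1) + i ≤ (j + 1) * (m + 1) := by rw [add_mul]; omega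
          _ ≤ _ := Nat.mul_le_mul_right _ hj)
    have e : noHit g m (M + 1) = noHit g m M \ mt g (m + 1) (M * (m + 1)) := by
      ext ω
      simp only [noHit, Set.mem_sdiff, Set.mem_ofPred_eq]
      constructor
      · exact fun h => ⟨fun j hj => h j (by omega), h M (by omega)⟩
      · rintro ⟨h1, h2⟩ j hj
        rcases Nat.lt_succ_iff_lt_or_eq.mp hj with h | rfl
        · exact h1 j h
        · exact h2
    have hd := measureReal_inter_add_sdiff (μ := P) (s := noHit g m M) (mt_meas g (m + 1) (M * (m + 1)))
    rw [← e] at hd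
    have h2 : P.real (noHit g m (M + 1)) ≤ (1 - c * pr Q g m) * P.real (noHit g m M) := by
      nlinarith
    calc _ ≤ _ := h2
      _ ≤ Real.exp (-(c * pr Q g m)) * Real.exp (- (c * pr Q g m * M)) := by
        gcongr
        have := Real.add_one_le_exp (-(c * pr Q g m))
        linarith
      _ = _ := by
        rw [← Real.exp_add]; congr 1; push_cast; ring

lemma hit_bound [Fintype A] [MeasurableSpace A] [MeasurableSingletonClass A]
    (Q : A → A → ℝ) (μ : A → ℝ) (P : Measure (ℕ → A)) [IsProbabilityMeasure P]
    (hQpos : ∀ x y, 0 < Q x y)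
    (hP : ∀ (n : ℕ) (a : ℕ → A),
      (P {ω | ∀ i ≤ n, ω i = a i}).toReal
        = μ (a 0) * ∏ i ∈ Finset.range n, Q (a i) (a (i + 1)))
    (hQ1 : ∀ x y, Q x y ≤ 1)
    (g : ℕ → A) (m N : ℕ) :
    P.real {ω | ∃ k < N, ω ∈ mt g (m + 1) k} ≤ N * pr Q g m := by
  have e : {ω | ∃ k < N, ω ∈ mt g (m + 1) k} = ⋃ k ∈ Finset.range N, mt g (m + 1) k := by
    ext; simp
  rw [e]
  refine (measureReal_biUnion_finset_le _ _).trans ?_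
  have : ∀ k ∈ Finset.range N, P.real (mt g (m + 1) k) ≤ pr Q g m := by
    intro k _
    have := (sandwich Q μ P hQpos hP 0 (fun x y => (hQpos x y).le) hQ1 g m k Set.univ
      (fun _ _ _ h => h)).2.2
    simpa using this
  simpa using Finset.sum_le_sum this

lemma main [Fintype A] [Nonempty A] [MeasurableSpace A] [MeasurableSingletonClass A]
    (Q : A → A → ℝ) (μ : A → ℝ) (P : Measure (ℕ → A)) [IsProbabilityMeasure P]
    (hQpos : ∀ x y, 0 < Q x y) (hQrow : ∀ x, ∑ y, Q x y = 1)
    (hP : ∀ (n : ℕ) (a : ℕ → A),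
      (P {ω | ∀ i ≤ n, ω i = a i}).toReal
        = μ (a 0) * ∏ i ∈ Finset.range n, Q (a i) (a (i + 1)))
    (g : ℕ → A) :
    ∀ᵐ ω ∂P, Tendsto (fun n : ℕ => (Real.log (hitTime n g ω)
      + ∑ i ∈ Finset.Icc 1 (n - 1), Real.log (Q (g i) (g (i + 1)))) / n) atTop (nhds 0) := by
  have hQ1 : ∀ x y, Q x y ≤ 1 := fun x y => by
    rw [← hQrow x]
    exact Finset.single_le_sum (f := fun y => Q x y) (fun y _ => (hQpos x y).le) (Finset.mem_univ y)
  obtain ⟨z, hz⟩ := Finite.exists_min (fun z : A × A => Q z.1 z.2)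
  set c := Q z.1 z.2 with hcdef
  have hc0 : 0 < c := hQpos _ _
  have hc : ∀ x y, c ≤ Q x y := fun x y => hz (x, y)
  have hp0 : ∀ m, 0 < pr Q g m := pr_pos Q hQpos g
  have hp1 : ∀ m, pr Q g m ≤ 1 := fun m =>
    Finset.prod_le_one (fun _ _ => (hQpos _ _).le) (fun _ _ => hQ1 _ _)
  let x : ℕ → ℝ := fun m => 1 / ((m + 1) ^ 2 * pr Q g m)
  have hx0 : ∀ m, 0 < x m := fun m => by have := hp0 m; positivity
  let M : ℕ → ℕ := fun m => ⌈(m + 1) / pr Q g m⌉₊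
  let N : ℕ → ℕ := fun m => if 1 < x m then ⌈x m⌉₊ else 0
  have b1 : ∀ᵐ ω ∂P, ∀ᶠ m in atTop, ω ∉ noHit g m (M m) := by
    refine ae_eventually_notMem ?_
    have hs : Summable (fun m : ℕ => Real.exp (-c) ^ (m + 1)) :=
      (summable_nat_add_iff 1).mpr (summable_geometric_of_lt_one (Real.exp_pos _).le
        (Real.exp_lt_one_iff.mpr (by linarith)))
    refine ne_top_of_le_ne_top hs.tsum_ofReal_ne_top (ENNReal.tsum_le_tsum fun m => ?_)
    rw [← ofReal_measureReal]
    refine ENNReal.ofReal_le_ofReal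
      ((noHit_bound Q μ P hQpos hP c hc hQ1 g m (M m)).trans ?_)
    rw [← Real.exp_nat_mul, Real.exp_le_exp]
    have h : (m + 1) / pr Q g m ≤ M m := Nat.le_ceil _
    rw [div_le_iff₀ (hp0 m)] at h
    push_cast
    nlinarith
  have b2 : ∀ᵐ ω ∂P, ∀ᶠ m in atTop, ω ∉ {ω | ∃ k < N m, ω ∈ mt g (m + 1) k} := by
    refine ae_eventually_notMem ?_
    have hs : Summable (fun m : ℕ => 2 * (1 / ((m + 1 : ℕ) : ℝ) ^ 2)) :=
      ((summable_nat_add_iff 1).mpr (Real.summable_one_div_nat_pow.mpr one_lt_two)).mul_left 2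
    refine ne_top_of_le_ne_top hs.tsum_ofReal_ne_top (ENNReal.tsum_le_tsum fun m => ?_)
    rw [← ofReal_measureReal]
    refine ENNReal.ofReal_le_ofReal
      ((hit_bound Q μ P hQpos hP hQ1 g m (N m)).trans ?_)
    have hN : (N m : ℝ) ≤ 2 * x m := by
      by_cases h : 1 < x m
      · simp only [N, if_pos h]
        have := Nat.ceil_lt_add_one (hx0 m).le
        linarith
      · simp only [N, if_neg h]
        have := hx0 m
        simp; linarith
    calc (N m : ℝ) * pr Q g m ≤ 2 * x m * pr Q g m := by have := hp0 m; gcongr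
      _ = _ := by
        have := (hp0 m).ne'
        simp only [x]; push_cast; field_simp
  filter_upwards [b1, b2] with ω h1 h2
  rw [← tendsto_add_atTop_iff_nat 1]
  have hlim : Tendsto (fun m : ℕ => (Real.log 2 + 2 * Real.log ((m + 1 : ℕ) : ℝ)) / ((m + 1 : ℕ) : ℝ))
      atTop (nhds 0) := by
    have hl : Tendsto (fun t : ℝ => (Real.log 2 + 2 * Real.log t) / t) atTop (nhds 0) := by
      have a1 : Tendsto (fun t : ℝ => Real.log t / t) atTop (nhds 0) :=
        Real.isLittleO_log_id_atTop.tendsto_div_nhds_zero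
      have a2 : Tendsto (fun t : ℝ => Real.log 2 / t) atTop (nhds 0) :=
        tendsto_const_nhds.div_atTop tendsto_id
      have := a2.add (a1.const_mul 2)
      simp only [mul_zero, add_zero] at this
      refine this.congr fun t => ?_
      ring
    exact hl.comp (tendsto_natCast_atTop_atTop.comp (tendsto_add_atTop_nat 1))
  refine squeeze_zero_norm' ?_ hlim
  filter_upwards [h1, h2] with m h1 h2
  have hS : ∑ i ∈ Finset.Icc 1 (m + 1 - 1), Real.log (Q (g i) (g (i + 1))) = Real.log (pr Q g m) := by
    rw [pr, Real.log_prod (fun i _ => (hQpos _ _).ne'), Nat.add_sub_cancel, Finset.range_eq_Ico,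
      Finset.sum_Ico_add' (fun i => Real.log (Q (g i) (g (i + 1)))) 0 m 1]
    rfl
  rw [hS, norm_div, Real.norm_natCast, Real.norm_eq_abs]
  refine div_le_div_of_nonneg_right ?_ (by positivity)
  simp only [noHit, Set.mem_ofPred_eq, not_forall, not_not] at h1
  obtain ⟨j, hj, hjm⟩ := h1
  have hp := hp0 m
  have hT1 : hitTime (m + 1) g ω ≤ j * (m + 1) := Nat.sInf_le hjm
  have hT2 : ω ∈ mt g (m + 1) (hitTime (m + 1) g ω) :=
    Nat.sInf_mem (s := {k | ∀ i, 1 ≤ i → i ≤ m + 1 → ω (k + i) = g i}) ⟨_, hjm⟩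
  have hT3 : N m ≤ hitTime (m + 1) g ω := by
    by_contra hlt
    exact h2 ⟨_, not_le.mp hlt, hT2⟩
  set T := hitTime (m + 1) g ω
  have hm1 : (1 : ℝ) ≤ ((m + 1 : ℕ) : ℝ) := by exact_mod_cast Nat.le_add_left 1 m
  have hlm : 0 ≤ Real.log ((m + 1 : ℕ) : ℝ) := Real.log_nonneg hm1
  have hl2 : 0 < Real.log 2 := Real.log_pos one_lt_two
  have hlx : Real.log (x m) = - (2 * Real.log ((m + 1 : ℕ) : ℝ) + Real.log (pr Q g m)) := by
    simp only [x]
    rw [one_div, Real.log_inv, Real.log_mul (by positivity) hp.ne', Real.log_pow]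
    push_cast; ring
  rw [abs_le]
  constructor
  · have : Real.log (x m) ≤ Real.log T := by
      by_cases h : 1 < x m
      · simp only [N, if_pos h] at hT3
        exact Real.log_le_log (hx0 m) ((Nat.le_ceil _).trans (by exact_mod_cast hT3))
      · exact (Real.log_nonpos (hx0 m).le (not_lt.mp h)).trans (Real.log_natCast_nonneg T)
    linarith
  · rcases Nat.eq_zero_or_pos T with h | h
    · have := Real.log_nonpos hp.le (hp1 m)
      rw [h]; simp only [Nat.cast_zero, Real.log_zero]; linarith
    · have hj' : (j : ℝ) ≤ (m + 1) / pr Q g m := by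
        have : j < ⌈(m + 1) / pr Q g m⌉₊ := hj
        exact (Nat.lt_ceil.mp this).le
      have hTT : (T : ℝ) ≤ ((m + 1 : ℕ) : ℝ) ^ 2 / pr Q g m := by
        calc (T : ℝ) ≤ j * ((m + 1 : ℕ) : ℝ) := by exact_mod_cast hT1
          _ ≤ (m + 1) / pr Q g m * ((m + 1 : ℕ) : ℝ) := by gcongr
          _ = _ := by push_cast; ring
      have := Real.log_le_log (by exact_mod_cast h) hTT
      rw [Real.log_div (by positivity) hp.ne', Real.log_pow] at this
      push_cast at this ⊢
      linarith

end Shadow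

/-- Shadowing a given trajectory: for a fixed target sequence `g`, the difference of the
logarithms of the hitting times of the two chains is, to leading order, the ergodic sum
`∑_{i=1}^{n-1} log (Q_X(g_i,g_{i+1})/Q_Y(g_i,g_{i+1}))`. -/
theorem stmt16
    {A : Type*} [Fintype A] [Nonempty A] [MeasurableSpace A] [MeasurableSingletonClass A]
    (QX QY : A → A → ℝ) (μ μt : A → ℝ)
    (hQXpos : ∀ x y, 0 < QX x y) (hQXrow : ∀ x, ∑ y, QX x y = 1)
    (hQYpos : ∀ x y, 0 < QY x y) (hQYrow : ∀ x, ∑ y, QY x y = 1)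
    (hμnonneg : ∀ x, 0 ≤ μ x) (hμsum : ∑ x, μ x = 1)
    (hμstat : ∀ y, ∑ x, μ x * QX x y = μ y)
    (hμtnonneg : ∀ x, 0 ≤ μt x) (hμtsum : ∑ x, μt x = 1)
    (hμtstat : ∀ y, ∑ x, μt x * QY x y = μt y)
    (P Pt : Measure (ℕ → A)) [IsProbabilityMeasure P] [IsProbabilityMeasure Pt]
    (hP : ∀ (n : ℕ) (a : ℕ → A),
      (P {ω | ∀ i ≤ n, ω i = a i}).toReal
        = μ (a 0) * ∏ i ∈ Finset.range n, QX (a i) (a (i + 1)))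
    (hPt : ∀ (n : ℕ) (a : ℕ → A),
      (Pt {ω | ∀ i ≤ n, ω i = a i}).toReal
        = μt (a 0) * ∏ i ∈ Finset.range n, QY (a i) (a (i + 1))) :
    ∀ g : ℕ → A,
      ∀ᵐ z ∂(P.prod Pt),
        Tendsto (fun n : ℕ =>
            (Real.log (hitTime n g z.2) - Real.log (hitTime n g z.1)
              - ∑ i ∈ Finset.Icc 1 (n - 1),
                  Real.log (QX (g i) (g (i + 1)) / QY (g i) (g (i + 1)))) / n)
          atTop (nhds 0) := by
  intro g
  have h1 := Measure.quasiMeasurePreserving_fst (μ := P) (ν := Pt) |>.ae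
    (Shadow.main QX μ P hQXpos hQXrow hP g)
  have h2 := Measure.quasiMeasurePreserving_snd (μ := P) (ν := Pt) |>.ae
    (Shadow.main QY μt Pt hQYpos hQYrow hPt g)
  filter_upwards [h1, h2] with z h1 h2
  have h := h2.sub h1
  rw [sub_zero] at h
  refine h.congr fun n => ?_
  have : ∑ i ∈ Finset.Icc 1 (n - 1), Real.log (QX (g i) (g (i + 1)) / QY (g i) (g (i + 1)))
      = ∑ i ∈ Finset.Icc 1 (n - 1), Real.log (QX (g i) (g (i + 1)))
        - ∑ i ∈ Finset.Icc 1 (n - 1), Real.log (QY (g i) (g (i + 1))) := by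
    rw [← Finset.sum_sub_distrib]
    exact Finset.sum_congr rfl fun i _ => Real.log_div (hQXpos _ _).ne' (hQYpos _ _).ne'
  rw [this]
  ring
end
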